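/- Let K ⊆ Σ* be a regular trace-closed language. Then the ω-language [lim(K)]_{≈_I} is ω-regular, i.e. it is recognized by a deterministic Muller automaton. -/

import Mathlib

open Relation

variable {A : Type*} {σ : Type*} {S : Type*}

/-- The length-`n` prefix of an ω-word. -/
def wpre (α : ℕ → A) (n : ℕ) : List A := (List.range n).map α

/-- One swap of two adjacent independent letters. -/
def SwapStep (I : A → A → Prop) (u v : List A) : Prop :=
  ∃ (x y : List A) (a b : A), I a b ∧ u = x ++ a :: b :: y ∧ v = x ++ b :: a :: y

/-- Trace equivalence `∼_I` on finite words: the equivalence closure of adjacent swaps. -/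
def TrEq (I : A → A → Prop) : List A → List A → Prop := EqvGen (SwapStep I)

/-- Trace-prefix relation `u ⊑_I v`. -/
def TrPre (I : A → A → Prop) (u v : List A) : Prop := ∃ w, TrEq I (u ++ w) v

/-- Trace equivalence `≈_I` of ω-words. -/
def OmEq (I : A → A → Prop) (α β : ℕ → A) : Prop :=
  (∀ n, ∃ m, TrPre I (wpre α n) (wpre β m)) ∧ (∀ n, ∃ m, TrPre I (wpre β n) (wpre α m))

/-- A language of finite words is trace-closed. -/
def TraceClosed (I : A → A → Prop) (K : Set (List A)) : Prop :=
  ∀ u v, u ∈ K → TrEq I u v → v ∈ K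

/-- An ω-language is trace-closed. -/
def OmTraceClosed (I : A → A → Prop) (L : Set (ℕ → A)) : Prop :=
  ∀ α β, α ∈ L → OmEq I α β → β ∈ L

/-- `ext(K)`: ω-words with some finite prefix in `K`. -/
def extL (K : Set (List A)) : Set (ℕ → A) := {α | ∃ n, wpre α n ∈ K}

/-- `lim(K)`: ω-words with infinitely many finite prefixes in `K`. -/
def limL (K : Set (List A)) : Set (ℕ → A) := {α | ∀ N, ∃ n ≥ N, wpre α n ∈ K}

/-- `[L]_{≈_I}`: the ω-trace closure of an ω-language. -/
def omCl (I : A → A → Prop) (L : Set (ℕ → A)) : Set (ℕ → A) := {α | ∃ β ∈ L, OmEq I α β}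

/-- The `I`-suffix extension `K_I`. -/
def suffExt (I : A → A → Prop) (K : Set (List A)) : Set (List A) :=
  K ∪ {w | ∃ (a : A) (u x : List A),
    u ++ [a] ∈ K ∧ (∀ b ∈ x, I a b) ∧ TrEq I w (u ++ [a] ++ x)}

/-- A language is regular iff it is recognized by a DFA with finitely many states. -/
def RegularLang (K : Set (List A)) : Prop :=
  ∃ (σ : Type) (_ : Fintype σ) (M : DFA A σ), ∀ w, w ∈ M.accepts ↔ w ∈ K

/-- A DFA is `I`-diamond. -/
def IDiamond (I : A → A → Prop) (M : DFA A σ) : Prop :=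
  ∀ q a b, I a b → M.step (M.step q a) b = M.step (M.step q b) a

/-- The ω-language of a DFA viewed as a deterministic Büchi automaton. -/
def BuchiLang (M : DFA A σ) : Set (ℕ → A) :=
  {α | ∀ N, ∃ n ≥ N, M.evalFrom M.start (wpre α n) ∈ M.accept}

/-- The weakness condition: mutually reachable states agree on acceptance. -/
def IsWeak (M : DFA A σ) : Prop :=
  ∀ q q', (∃ u, M.evalFrom q u = q') → (∃ v, M.evalFrom q' v = q) →
    (q ∈ M.accept ↔ q' ∈ M.accept)

/-- States visited infinitely often by the run of a DFA on an ω-word. -/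
def InfStates (M : DFA A σ) (α : ℕ → A) : Set σ :=
  {q | ∀ N, ∃ n ≥ N, M.evalFrom M.start (wpre α n) = q}

/-- The ω-language of a DFA equipped with a Muller acceptance family. -/
def MullerLang (M : DFA A σ) (F : Set (Set σ)) : Set (ℕ → A) := {α | InfStates M α ∈ F}

/-- An ω-language is ω-regular iff it is recognized by a deterministic Muller automaton. -/
def OmegaRegular (L : Set (ℕ → A)) : Prop :=
  ∃ (σ : Type) (_ : Fintype σ) (M : DFA A σ) (F : Set (Set σ)), MullerLang M F = L

/-- Finite Boolean combinations of a family of sets. -/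
inductive BoolComb {X : Type*} (G : Set (Set X)) : Set X → Prop
  | base {L} : L ∈ G → BoolComb G L
  | compl {L} : BoolComb G L → BoolComb G Lᶜ
  | union {L₁ L₂} : BoolComb G L₁ → BoolComb G L₂ → BoolComb G (L₁ ∪ L₂)
  | inter {L₁ L₂} : BoolComb G L₁ → BoolComb G L₂ → BoolComb G (L₁ ∩ L₂)

/-- `φ : Σ* → S` is a monoid homomorphism (words under concatenation). -/
def IsHom [Monoid S] (φ : List A → S) : Prop :=
  φ [] = 1 ∧ ∀ u v, φ (u ++ v) = φ u * φ v

/-- Linked pair of a monoid. -/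
def LinkedPair [Monoid S] (s e : S) : Prop := s * e = s ∧ e * e = e

/-- The factor `α[i, j)` of an ω-word. -/
def seg (α : ℕ → A) (i j : ℕ) : List A := (List.range (j - i)).map (fun k => α (i + k))

/-- `φ⁻¹(s)·(φ⁻¹(e))^ω`: ω-words admitting a factorization `u·v₁·v₂⋯` with
`φ(u) = s` and `φ(vᵢ) = e`. -/
def LPWords (φ : List A → S) (s e : S) : Set (ℕ → A) :=
  {α | ∃ n : ℕ → ℕ, StrictMono n ∧ φ (wpre α (n 0)) = s ∧
    ∀ i, φ (seg α (n i) (n (i + 1))) = e}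

/-- `φ` saturates an ω-language `L`. -/
def Saturates [Monoid S] (φ : List A → S) (L : Set (ℕ → A)) : Prop :=
  ∀ s e : S, LinkedPair s e → LPWords φ s e ∩ L = ∅ ∨ LPWords φ s e ⊆ L

/-- The `P`-cut property of a linked pair `(s, e)` with respect to `φ`. -/
def PCut [Monoid S] (φ : List A → S) (P : Set S) (s e : S) : Prop :=
  (∀ w : List A, w ≠ [] → φ w = e →
      ∃ j, 1 ≤ j ∧ j ≤ w.length ∧ s * e * φ (w.take j) ∈ P) ∨
  (∀ w : List A, w ≠ [] → φ w = e →
      ∀ j, 1 ≤ j → j ≤ w.length → s * e * φ (w.take j) ∉ P)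

/-- The run from `q` on `u` visits an accepting state (endpoints included). -/
def VisitsAcc (M : DFA A σ) (q : σ) (u : List A) : Prop :=
  ∃ p, p <+: u ∧ M.evalFrom q p ∈ M.accept

/-- `q ⇒_u q'`: the run from `q` on `u` ends in `q'` and visits an accepting state. -/
def FICycleClosed (I : A → A → Prop) (M : DFA A σ) : Prop :=
  ∀ u v q, TrEq I u v →
    ((M.evalFrom q u = q ∧ VisitsAcc M q u) ↔ (M.evalFrom q v = q ∧ VisitsAcc M q v))

section helpers

theorem SwapStep.symm' {I : A → A → Prop} (hsym : ∀ a b, I a b → I b a) {u v : List A}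
    (h : SwapStep I u v) : SwapStep I v u := by
  obtain ⟨x, y, a, b, hab, rfl, rfl⟩ := h
  exact ⟨x, y, b, a, hsym _ _ hab, rfl, rfl⟩

theorem TrEq.refl' (I : A → A → Prop) (u : List A) : TrEq I u u := EqvGen.refl _

theorem TrEq.symm' {I : A → A → Prop} {u v : List A} (h : TrEq I u v) : TrEq I v u :=
  EqvGen.symm _ _ h

theorem TrEq.trans' {I : A → A → Prop} {u v w : List A} (h : TrEq I u v) (h' : TrEq I v w) :
    TrEq I u w := EqvGen.trans _ _ _ h h'

theorem TrEq.ctx {I : A → A → Prop} {u v : List A} (h : TrEq I u v) (p s : List A) :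
    TrEq I (p ++ u ++ s) (p ++ v ++ s) := by
  induction h with
  | rel u v h =>
    obtain ⟨x, y, a, b, hab, rfl, rfl⟩ := h
    exact EqvGen.rel _ _ ⟨p ++ x, y ++ s, a, b, hab, by simp, by simp⟩
  | refl u => exact EqvGen.refl _
  | symm _ _ _ ih => exact EqvGen.symm _ _ ih
  | trans _ _ _ _ _ ih1 ih2 => exact EqvGen.trans _ _ _ ih1 ih2

theorem TrEq.left {I : A → A → Prop} {u v : List A} (h : TrEq I u v) (p : List A) :
    TrEq I (p ++ u) (p ++ v) := by simpa using h.ctx p []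

theorem TrEq.right {I : A → A → Prop} {u v : List A} (h : TrEq I u v) (s : List A) :
    TrEq I (u ++ s) (v ++ s) := by simpa using h.ctx [] s

theorem TrEq.length {I : A → A → Prop} {u v : List A} (h : TrEq I u v) :
    u.length = v.length := by
  induction h with
  | rel u v h =>
    obtain ⟨x, y, a, b, hab, rfl, rfl⟩ := h
    simp
  | refl u => rfl
  | symm _ _ _ ih => exact ih.symm
  | trans _ _ _ _ _ ih1 ih2 => exact ih1.trans ih2

/-- moving a letter to the front -/
theorem TrEq.move {I : A → A → Prop} (a : A) (u v : List A) (h : ∀ b ∈ u, I b a) :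
    TrEq I (u ++ a :: v) (a :: (u ++ v)) := by
  induction u with
  | nil => exact TrEq.refl' _ _
  | cons b u ih =>
    have h1 := (ih (fun c hc => h c (by simp [hc]))).left [b]
    refine TrEq.trans' (by simpa using h1) ?_
    exact EqvGen.rel _ _ ⟨[], u ++ v, b, a, h b (by simp), by simp, by simp⟩

theorem levi_step {I : A → A → Prop} (hsym : ∀ a b, I a b → I b a) {u v : List A} (h : SwapStep I u v)
    (a : A) (u1 u2 : List A) (hu : u = u1 ++ a :: u2) (hi : ∀ b ∈ u1, I b a) :
    ∃ v1 v2, v = v1 ++ a :: v2 ∧ (∀ b ∈ v1, I b a) ∧ TrEq I (u1 ++ u2) (v1 ++ v2) := by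
  obtain ⟨x, y, c, d, hcd, rfl, rfl⟩ := h
  rcases List.append_eq_append_iff.1 hu with ⟨t, ht, ht'⟩ | ⟨t, ht, ht'⟩
  · -- u1 = x ++ t, c :: d :: y = t ++ a :: u2
    subst ht
    rcases t with _ | ⟨c', t⟩
    · simp at ht'
      obtain ⟨rfl, rfl⟩ := ht'
      refine ⟨x ++ [d], y, by simp, ?_, by simpa using TrEq.refl' _ _⟩
      intro b hb
      simp at hb hi
      rcases hb with hb | rfl
      · exact hi b hb
      · exact hsym _ _ hcd
    · simp at ht'
      obtain ⟨rfl, ht'⟩ := ht'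
      rcases t with _ | ⟨d', t⟩
      · simp at ht'
        obtain ⟨rfl, rfl⟩ := ht'
        refine ⟨x, c :: y, by simp, fun b hb => hi b (by simp [hb]), ?_⟩
        simpa using TrEq.refl' _ _
      · simp at ht'
        obtain ⟨rfl, rfl⟩ := ht'
        refine ⟨x ++ d :: c :: t, u2, by simp, fun b hb => hi b (by simp at hb ⊢; tauto), ?_⟩
        exact EqvGen.rel _ _ ⟨x, t ++ u2, c, d, hcd, by simp, by simp⟩
  · -- x = u1 ++ t, a :: u2 = t ++ c :: d :: y
    subst ht
    rcases t with _ | ⟨a', t⟩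
    · simp at ht'
      obtain ⟨rfl, rfl⟩ := ht'
      refine ⟨u1 ++ [d], y, by simp, ?_, by simpa using TrEq.refl' _ _⟩
      intro b hb
      simp at hb
      rcases hb with hb | rfl
      · exact hi b hb
      · exact hsym _ _ hcd
    · simp at ht'
      obtain ⟨rfl, rfl⟩ := ht'
      refine ⟨u1, t ++ d :: c :: y, by simp, hi, ?_⟩
      exact EqvGen.rel _ _ ⟨u1 ++ t, y, c, d, hcd, by simp, by simp⟩

theorem levi_aux {I : A → A → Prop} (hsym : ∀ a b, I a b → I b a) {u v : List A}
    (h : TrEq I u v) (a : A) :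
    (∀ u1 u2, u = u1 ++ a :: u2 → (∀ b ∈ u1, I b a) →
      ∃ v1 v2, v = v1 ++ a :: v2 ∧ (∀ b ∈ v1, I b a) ∧ TrEq I (u1 ++ u2) (v1 ++ v2)) ∧
    (∀ u1 u2, v = u1 ++ a :: u2 → (∀ b ∈ u1, I b a) →
      ∃ v1 v2, u = v1 ++ a :: v2 ∧ (∀ b ∈ v1, I b a) ∧ TrEq I (u1 ++ u2) (v1 ++ v2)) := by
  induction h with
  | rel u v h => exact ⟨levi_step hsym h a, levi_step hsym (h.symm' hsym) a⟩
  | refl u =>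
    exact ⟨fun u1 u2 h hi => ⟨u1, u2, h, hi, TrEq.refl' _ _⟩,
      fun u1 u2 h hi => ⟨u1, u2, h, hi, TrEq.refl' _ _⟩⟩
  | symm _ _ _ ih => exact ⟨ih.2, ih.1⟩
  | trans _ _ _ _ _ ih1 ih2 =>
    constructor
    · intro u1 u2 h hi
      obtain ⟨v1, v2, h', hi', e⟩ := ih1.1 u1 u2 h hi
      obtain ⟨w1, w2, h'', hi'', e'⟩ := ih2.1 v1 v2 h' hi'
      exact ⟨w1, w2, h'', hi'', e.trans' e'⟩
    · intro u1 u2 h hi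
      obtain ⟨v1, v2, h', hi', e⟩ := ih2.2 u1 u2 h hi
      obtain ⟨w1, w2, h'', hi'', e'⟩ := ih1.2 v1 v2 h' hi'
      exact ⟨w1, w2, h'', hi'', e.trans' e'⟩

theorem levi {I : A → A → Prop} (hsym : ∀ a b, I a b → I b a) {a : A} {w v : List A}
    (h : TrEq I (a :: w) v) :
    ∃ v1 v2, v = v1 ++ a :: v2 ∧ (∀ b ∈ v1, I b a) ∧ TrEq I w (v1 ++ v2) :=
  (levi_aux hsym h a).1 [] w rfl (by simp)

theorem TrEq.cancel {I : A → A → Prop} (hirr : ∀ a, ¬ I a a) (hsym : ∀ a b, I a b → I b a)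
    (p : List A) {u v : List A} (h : TrEq I (p ++ u) (p ++ v)) : TrEq I u v := by
  induction p with
  | nil => exact h
  | cons a p ih =>
    obtain ⟨v1, v2, h1, h2, h3⟩ := levi hsym h
    rcases v1 with _ | ⟨b, v1⟩
    · simp at h1
      subst h1
      exact ih h3
    · simp at h1
      obtain ⟨rfl, -⟩ := h1
      exact absurd (h2 a (by simp)) (hirr a)

/-- one step of the splitting NFA -/
def splitStep (I : A → A → Prop) (M : DFA A σ) (s : σ × Set A) (a : A) (t : σ × Set A) : Prop :=
  ((∀ b ∈ s.2, I b a) ∧ t = (M.step s.1 a, s.2)) ∨ t = (s.1, insert a s.2)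

/-- runs of the splitting NFA -/
def splitRun (I : A → A → Prop) (M : DFA A σ) : σ × Set A → List A → σ × Set A → Prop
  | s, [], t => s = t
  | s, a :: w, t => ∃ r, splitStep I M s a r ∧ splitRun I M r w t

theorem splitRun_snoc (I : A → A → Prop) (M : DFA A σ) (s : σ × Set A) (w : List A) (a : A)
    (t : σ × Set A) :
    splitRun I M s (w ++ [a]) t ↔ ∃ r, splitRun I M s w r ∧ splitStep I M r a t := by
  induction w generalizing s with
  | nil => simp [splitRun]
  | cons b w ih =>
    simp only [List.cons_append, splitRun, ih]
    constructor
    · rintro ⟨r, h1, r', h2, h3⟩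
      exact ⟨r', ⟨r, h1, h2⟩, h3⟩
    · rintro ⟨r', ⟨r, h1, h2⟩, h3⟩
      exact ⟨r, h1, r', h2, h3⟩

theorem splitRun_sound {I : A → A → Prop} (M : DFA A σ) (hsym : ∀ a b, I a b → I b a)
    (w : List A) (s t : σ × Set A) (h : splitRun I M s w t) :
    ∃ x y, M.evalFrom s.1 x = t.1 ∧ (∀ b ∈ s.2, ∀ c ∈ x, I b c) ∧ TrEq I (x ++ y) w := by
  induction w generalizing s with
  | nil =>
    cases h
    exact ⟨[], [], rfl, by simp, TrEq.refl' _ _⟩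
  | cons a w ih =>
    obtain ⟨r, hr, h⟩ := h
    obtain ⟨x, y, h1, h2, h3⟩ := ih r h
    rcases hr with ⟨hi, rfl⟩ | rfl
    · refine ⟨a :: x, y, h1, ?_, by simpa using h3.left [a]⟩
      intro b hb c hc
      rcases List.mem_cons.1 hc with rfl | hc
      · exact hi b hb
      · exact h2 b hb c hc
    · refine ⟨x, a :: y, h1, fun b hb c hc => h2 b (Set.mem_insert_of_mem _ hb) c hc, ?_⟩
      exact (TrEq.move a x y fun b hb => hsym _ _ (h2 a (Set.mem_insert _ _) b hb)).trans'
        (by simpa using h3.left [a])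

theorem splitRun_complete {I : A → A → Prop} (M : DFA A σ) (hsym : ∀ a b, I a b → I b a)
    (w : List A) (s : σ × Set A) (x y : List A) (hx : ∀ b ∈ s.2, ∀ c ∈ x, I b c)
    (h : TrEq I w (x ++ y)) :
    ∃ x' t, TrEq I x' x ∧ splitRun I M s w t ∧ t.1 = M.evalFrom s.1 x' := by
  induction w generalizing s x y with
  | nil =>
    have := h.length
    simp at this
    obtain ⟨rfl, rfl⟩ : x = [] ∧ y = [] := by
      constructor <;> apply List.length_eq_zero_iff.1 <;> omega
    exact ⟨[], s, TrEq.refl' _ _, rfl, rfl⟩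
  | cons a w ih =>
    obtain ⟨v1, v2, h1, h2, h3⟩ := levi hsym h
    have key : (∃ x2, x = v1 ++ a :: x2 ∧ v2 = x2 ++ y) ∨
        (∃ y1, v1 = x ++ y1 ∧ y = y1 ++ a :: v2) := by
      rcases List.append_eq_append_iff.1 h1 with ⟨t, ht, ht'⟩ | ⟨t, ht, ht'⟩
      · exact Or.inr ⟨t, ht, ht'⟩
      · rcases t with _ | ⟨a', t⟩
        · refine Or.inr ⟨[], by simpa using ht.symm, by simpa using ht'.symm⟩
        · simp at ht'
          obtain ⟨rfl, rfl⟩ := ht'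
          exact Or.inl ⟨t, ht, rfl⟩
    rcases key with ⟨x2, rfl, rfl⟩ | ⟨y1, rfl, rfl⟩
    · obtain ⟨x', t, e1, e2, e3⟩ := ih (M.step s.1 a, s.2) (v1 ++ x2) y
        (fun b hb c hc => hx b hb c (by simp at hc ⊢; tauto)) (by simpa using h3)
      refine ⟨a :: x', t, ?_, ⟨_, Or.inl ⟨fun b hb => hx b hb a (by simp), rfl⟩, e2⟩, e3⟩
      exact TrEq.trans' (by simpa using e1.left [a]) (TrEq.move a v1 x2 h2).symm'
    · obtain ⟨x', t, e1, e2, e3⟩ := ih (s.1, insert a s.2) x (y1 ++ v2)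
        (by
          intro b hb c hc
          rcases Set.mem_insert_iff.1 hb with rfl | hb
          · exact hsym _ _ (h2 c (by simp [hc]))
          · exact hx b hb c hc) (by simpa using h3)
      exact ⟨x', t, e1, ⟨_, Or.inr rfl, e2⟩, e3⟩

theorem wpre_length (α : ℕ → A) (n : ℕ) : (wpre α n).length = n := by simp [wpre]

theorem wpre_succ (α : ℕ → A) (n : ℕ) : wpre α (n + 1) = wpre α n ++ [α n] := by
  simp [wpre, List.range_succ]

theorem wpre_seg (α : ℕ → A) {n m : ℕ} (h : n ≤ m) : wpre α m = wpre α n ++ seg α n m := by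
  obtain ⟨k, rfl⟩ := Nat.exists_eq_add_of_le h
  simp [wpre, seg, List.range_add]

theorem seg_self (α : ℕ → A) (n : ℕ) : seg α n n = [] := by simp [seg]

theorem seg_succ (α : ℕ → A) {n m : ℕ} (h : n ≤ m) : seg α n (m + 1) = seg α n m ++ [α m] := by
  have h1 := wpre_succ α m
  rw [wpre_seg α h, wpre_seg α (h.trans m.le_succ), List.append_assoc] at h1
  exact List.append_cancel_left h1

theorem seg_append (α : ℕ → A) {n m k : ℕ} (h : n ≤ m) (h' : m ≤ k) :
    seg α n k = seg α n m ++ seg α m k := by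
  have h1 := wpre_seg α (h.trans h')
  rw [wpre_seg α h', wpre_seg α h, List.append_assoc] at h1
  exact (List.append_cancel_left h1).symm

/-- from position `n` one can complete to a word of `K`, along a trace prefix -/
def Good (I : A → A → Prop) (K : Set (List A)) (α : ℕ → A) (n : ℕ) : Prop :=
  ∃ m x y, n ≤ m ∧ wpre α n ++ x ∈ K ∧ TrEq I (x ++ y) (seg α n m)

theorem Good.mono {I : A → A → Prop} {K : Set (List A)} {α : ℕ → A} {n N : ℕ} (hN : N ≤ n)
    (h : Good I K α n) : Good I K α N := by
  obtain ⟨m, x, y, h1, h2, h3⟩ := h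
  refine ⟨m, seg α N n ++ x, y, hN.trans h1, ?_, ?_⟩
  · rwa [← List.append_assoc, ← wpre_seg α hN]
  · rw [seg_append α hN h1, List.append_assoc]
    exact h3.left _

theorem Good.strict {I : A → A → Prop} {K : Set (List A)} {α : ℕ → A} {n : ℕ}
    (h : Good I K α n) :
    ∃ m x y, n < m ∧ wpre α n ++ x ∈ K ∧ TrEq I (x ++ y) (seg α n m) := by
  obtain ⟨m, x, y, h1, h2, h3⟩ := h
  refine ⟨m + 1, x, y ++ [α m], by omega, h2, ?_⟩
  rw [seg_succ α h1, ← List.append_assoc]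
  exact h3.right _

theorem good_of_mem {I : A → A → Prop} (hirr : ∀ a, ¬ I a a) (hsym : ∀ a b, I a b → I b a)
    {K : Set (List A)} (hK : TraceClosed I K) {α : ℕ → A} (h : α ∈ omCl I (limL K)) (n : ℕ) :
    Good I K α n := by
  obtain ⟨β, hβ, h1, h2⟩ := h
  obtain ⟨m, w, hw⟩ := h1 n
  obtain ⟨m', hm, hm'⟩ := hβ m
  obtain ⟨M, y, hy⟩ := h2 m'
  have e1 : TrEq I (wpre α n ++ (w ++ seg β m m')) (wpre β m') := by
    rw [wpre_seg β hm, ← List.append_assoc]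
    exact hw.right _
  have e2 : TrEq I (wpre α n ++ (w ++ seg β m m') ++ y) (wpre α M) := (e1.right y).trans' hy
  have hnM : n ≤ M := by
    have := e2.length
    simp [wpre_length] at this
    omega
  refine ⟨M, w ++ seg β m m', y, hnM, hK _ _ hm' e1.symm', ?_⟩
  rw [wpre_seg α hnM, List.append_assoc] at e2
  exact e2.cancel hirr hsym

theorem exists_limit (B : ℕ → List A) (hB : ∀ i, B i <+: B (i + 1))
    (hl : ∀ i, i < (B (i + 1)).length) :
    ∃ β : ℕ → A, ∀ i n, n ≤ (B i).length → wpre β n = (B i).take n := by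
  have hmono : ∀ i j, i ≤ j → B i <+: B j := by
    intro i j h
    induction h with
    | refl => exact List.prefix_rfl
    | step _ ih => exact ih.trans (hB _)
  refine ⟨fun k => (B (k + 1))[k]'(hl k), fun i n hn => ?_⟩
  apply List.ext_getElem
  · simp [wpre_length, hn]
  · intro k hk hk'
    have hkn : k < n := by simpa [wpre_length] using hk
    simp only [wpre, List.getElem_map, List.getElem_range, List.getElem_take]
    rcases le_total (k + 1) i with h | h
    · exact (hmono _ _ h).getElem _
    · exact ((hmono _ _ h).getElem _).symm

theorem mem_of_good {I : A → A → Prop}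
    {K : Set (List A)} (hK : TraceClosed I K) {α : ℕ → A} (h : ∀ n, Good I K α n) :
    α ∈ omCl I (limL K) := by
  choose m x y h1 h2 h3 using fun n => (h n).strict
  let n : ℕ → ℕ := fun i => Nat.rec 0 (fun _ k => m k) i
  have hn : ∀ i, n (i + 1) = m (n i) := fun _ => rfl
  have hni : ∀ i, i ≤ n i := by
    intro i
    induction i with
    | zero => exact Nat.zero_le _
    | succ i ih => rw [hn]; have := h1 (n i); omega
  let B : ℕ → List A := fun i => Nat.rec (x 0) (fun i b => b ++ y (n i) ++ x (n (i + 1))) i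
  have hB : ∀ i, B (i + 1) = B i ++ y (n i) ++ x (n (i + 1)) := fun _ => rfl
  have hBe : ∀ i, TrEq I (B i) (wpre α (n i) ++ x (n i)) := by
    intro i
    induction i with
    | zero => exact TrEq.refl' _ _
    | succ i ih =>
      rw [hB]
      apply TrEq.right
      refine (ih.right _).trans' ?_
      rw [hn, wpre_seg α (h1 (n i)).le, List.append_assoc]
      exact (h3 _).left _
  have hBl : ∀ i, i ≤ (B i).length := by
    intro i
    have := (hBe i).length
    simp [wpre_length] at this
    have := hni i
    omega
  obtain ⟨β, hβ⟩ := exists_limit B (fun i => by rw [hB, List.append_assoc]; exact List.prefix_append _ _)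
    (fun i => hBl (i + 1))
  have hβ' : ∀ i, wpre β (B i).length = B i := fun i => by rw [hβ i _ le_rfl]; simp
  refine ⟨β, fun N => ⟨_, hBl N, ?_⟩, fun N => ⟨(B N).length, ?_⟩, fun N => ⟨n (N + 1), ?_⟩⟩
  · rw [hβ']
    exact hK _ _ (h2 _) (hBe N).symm'
  · refine ⟨seg α N (n N) ++ x (n N), ?_⟩
    rw [hβ', ← List.append_assoc, ← wpre_seg α (hni N)]
    exact (hBe N).symm'
  · refine ⟨(B N).drop N ++ y (n N), ?_⟩
    rw [hβ N N (hBl N), ← List.append_assoc, List.take_append_drop, hn,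
      wpre_seg α (h1 (n N)).le]
    refine ((hBe N).right _).trans' ?_
    rw [List.append_assoc]
    exact (h3 _).left _

/-- acceptance of a set of splitting states -/
def Ful (M : DFA A σ) (T : Set (σ × Set A)) : Prop := ∃ s ∈ T, s.1 ∈ M.accept

/-- the breakpoint automaton -/
def brk (I : A → A → Prop) (M : DFA A σ) : DFA A (σ × Set (σ × Set A)) where
  start := (M.start, {(M.start, ∅)})
  accept := {s | Ful M s.2}
  step s a := (M.step s.1 a,
    insert (M.step s.1 a, ∅) {t | ¬ Ful M s.2 ∧ ∃ r ∈ s.2, splitStep I M r a t})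

theorem brk_fst (I : A → A → Prop) (M : DFA A σ) (α : ℕ → A) (n : ℕ) :
    ((brk I M).evalFrom (brk I M).start (wpre α n)).1 = M.evalFrom M.start (wpre α n) := by
  induction n with
  | zero => rfl
  | succ n ih =>
    rw [wpre_succ, DFA.evalFrom_append_singleton, DFA.evalFrom_append_singleton, ← ih]
    rfl

theorem brk_snd (I : A → A → Prop) (M : DFA A σ) (α : ℕ → A) (m : ℕ) (t : σ × Set A) :
    t ∈ ((brk I M).evalFrom (brk I M).start (wpre α m)).2 ↔
    ∃ n ≤ m, (∀ k, n ≤ k → k < m → ¬ Ful M ((brk I M).evalFrom (brk I M).start (wpre α k)).2) ∧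
      splitRun I M (M.evalFrom M.start (wpre α n), ∅) (seg α n m) t := by
  induction m generalizing t with
  | zero =>
    constructor
    · intro h
      refine ⟨0, le_rfl, by intros; omega, ?_⟩
      rw [seg_self]
      exact (Set.mem_singleton_iff.1 h).symm
    · rintro ⟨n, hn, -, h⟩
      obtain rfl : n = 0 := by omega
      rw [seg_self] at h
      exact Set.mem_singleton_iff.2 h.symm
  | succ m ih =>
    have e : ((brk I M).evalFrom (brk I M).start (wpre α (m + 1))).2 =
      insert (M.evalFrom M.start (wpre α (m + 1)), ∅)
        {t | ¬ Ful M ((brk I M).evalFrom (brk I M).start (wpre α m)).2 ∧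
          ∃ r ∈ ((brk I M).evalFrom (brk I M).start (wpre α m)).2, splitStep I M r (α m) t} := by
      rw [← brk_fst I M α (m + 1), wpre_succ, DFA.evalFrom_append_singleton]
      rfl
    rw [e, Set.mem_insert_iff]
    constructor
    · rintro (rfl | ⟨hF, r, hr, hs⟩)
      · refine ⟨m + 1, le_rfl, by intros; omega, ?_⟩
        rw [seg_self]
        rfl
      · obtain ⟨n, hn, h1, h2⟩ := (ih r).1 hr
        refine ⟨n, by omega, ?_, ?_⟩
        · intro k hk hk'
          rcases Nat.lt_succ_iff_lt_or_eq.1 hk' with h | rfl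
          · exact h1 k hk h
          · exact hF
        · rw [seg_succ α hn, splitRun_snoc]
          exact ⟨r, h2, hs⟩
    · rintro ⟨n, hn, h1, h2⟩
      rcases Nat.le_succ_iff.1 hn with hn | rfl
      · right
        rw [seg_succ α hn, splitRun_snoc] at h2
        obtain ⟨r, h2, h3⟩ := h2
        exact ⟨h1 m hn (by omega), r, (ih r).2 ⟨n, hn, fun k hk hk' => h1 k hk (by omega), h2⟩, h3⟩
      · left
        rw [seg_self] at h2
        exact h2.symm

theorem brk_lang {I : A → A → Prop} (hirr : ∀ a, ¬ I a a) (hsym : ∀ a b, I a b → I b a)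
    {K : Set (List A)} (hK : TraceClosed I K) (M : DFA A σ) (hM : ∀ w, w ∈ M.accepts ↔ w ∈ K) :
    BuchiLang (brk I M) = omCl I (limL K) := by
  have hM' : ∀ w, M.evalFrom M.start w ∈ M.accept ↔ w ∈ K := hM
  ext α
  constructor
  · intro h
    apply mem_of_good hK
    intro N
    obtain ⟨k, hk, hk'⟩ := h N
    obtain ⟨m, hm, t, ht, hta⟩ := h (k + 1)
    obtain ⟨n, hn, h1, h2⟩ := (brk_snd I M α m t).1 ht
    have hkn : k < n := by
      by_contra hc
      exact h1 k (by omega) (by omega) hk'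
    obtain ⟨x, y, e1, -, e2⟩ := splitRun_sound M hsym _ _ _ h2
    have : Good I K α n := by
      refine ⟨m, x, y, hn, ?_, e2⟩
      rw [← hM', DFA.evalFrom_of_append, e1]
      exact hta
    exact this.mono (by omega)
  · intro h N
    obtain ⟨m, x, y, h1, h2, h3⟩ := good_of_mem hirr hsym hK h N
    obtain ⟨x', t, e1, e2, e3⟩ := splitRun_complete M hsym _ (M.evalFrom M.start (wpre α N), ∅)
      x y (by simp) h3.symm'
    by_contra hc
    push Not at hc
    refine hc m h1 ⟨t, (brk_snd I M α m t).2 ⟨N, h1, fun k hk _ => hc k hk, e2⟩, ?_⟩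
    rw [e3, ← DFA.evalFrom_of_append, hM']
    exact hK _ _ h2 (e1.symm'.left _)

theorem omegaRegular_buchi [Finite S] (M : DFA A S) : OmegaRegular (BuchiLang M) := by
  obtain ⟨n, ⟨e⟩⟩ := Finite.exists_equiv_fin S
  refine ⟨Fin n, inferInstance, DFA.reindex e M, {Q | ∃ q ∈ Q, e.symm q ∈ M.accept}, ?_⟩
  have hr : ∀ w, (DFA.reindex e M).evalFrom (DFA.reindex e M).start w
      = e (M.evalFrom M.start w) := fun w => DFA.eval_reindex M e w
  ext α
  constructor
  · rintro ⟨q, hq, hqa⟩ N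
    obtain ⟨k, hk, hk'⟩ := hq N
    refine ⟨k, hk, ?_⟩
    rw [← hk', hr, Equiv.symm_apply_apply] at hqa
    exact hqa
  · intro h
    by_contra hc
    have : ∀ q : Fin n, e.symm q ∈ M.accept → ∃ N, ∀ k ≥ N,
        e (M.evalFrom M.start (wpre α k)) ≠ q := by
      intro q hq
      by_contra hcq
      push Not at hcq
      exact hc ⟨q, fun N => by obtain ⟨k, hk, hk'⟩ := hcq N; exact ⟨k, hk, by rw [hr, hk']⟩, hq⟩
    choose! N hN using this
    obtain ⟨k, hk, hk'⟩ := h (Finset.univ.sup N)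
    exact hN (e (M.evalFrom M.start (wpre α k))) (by simpa using hk') k
      ((Finset.le_sup (Finset.mem_univ _)).trans hk) rfl

end helpers

/-- For regular trace-closed `K`, the ω-language `[lim(K)]_{≈_I}`
is recognized by a deterministic Muller automaton. -/
theorem stmt16 [Fintype A] (I : A → A → Prop)
    (hirr : ∀ a, ¬ I a a) (hsym : ∀ a b, I a b → I b a)
    (K : Set (List A)) (hreg : RegularLang K) (hK : TraceClosed I K) :
    OmegaRegular (omCl I (limL K)) := by
  obtain ⟨σ, _, M, hM⟩ := hreg
  rw [← brk_lang hirr hsym hK M hM]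
  exact omegaRegular_buchi _
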